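/- (Forelli's theorem for translation on ℝ.) Let σ be a finite positive Borel measure on ℝ that is quasi-invariant: for every t ∈ ℝ and every Borel set A, σ(A) = 0 if and only if σ(A + t) = 0. Let μ be a complex Borel measure on ℝ, represented by a pair (ρ, f), such that for every Borel set A the function t ↦ μ(A + t) is Borel measurable and ∫_ℝ g(t)·μ(A + t) dt = 0 for every g ∈ H¹(ℝ) (i.e., μ is weakly analytic for the translation action T_tμ(A) = μ(A + t)). Suppose μ = μ₁ + μ₂ (i.e., μ(A) = μ₁(A) + μ₂(A) for all Borel A), where μ₁, μ₂ are complex Borel measures with μ₁ absolutely continuous with respect to σ (μ₁(B) = 0 whenever σ(B) = 0) and μ₂ singular with respect to σ (there is a Borel set D with σ(D) = 0 such that μ₂(B) = 0 for every Borel B ⊆ ℝ∖D). Then μ₁ and μ₂ are also weakly analytic: for i = 1, 2 and every Borel set A, the function t ↦ μ_i(A + t) is Borel measurable and ∫_ℝ g(t)·μ_i(A + t) dt = 0 for every g ∈ H¹(ℝ). -/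

import Mathlib

open MeasureTheory Filter
open scoped FourierTransform

/-- A function holomorphic on the closed upper half-plane and decaying there like `‖z‖⁻²` has
integral zero over the real line. -/
theorem integral_eq_zero_of_differentiableAt_upperHalfPlane {G : ℂ → ℂ} {C : ℝ}
    (hG : ∀ z : ℂ, 0 ≤ z.im → DifferentiableAt ℂ G z)
    (hb : ∀ z : ℂ, 0 ≤ z.im → ‖G z‖ * ‖z‖ ^ 2 ≤ C)
    (hi : Integrable fun x : ℝ => G x) : ∫ x : ℝ, G x = 0 := by
  have key : ∀ R : ℝ, 0 < R → ‖∫ x in (-R)..R, G x‖ ≤ 4 * C / R := by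
    intro R hR
    have hbd : ∀ z : ℂ, 0 ≤ z.im → R ≤ ‖z‖ → ‖G z‖ ≤ C / R ^ 2 := by
      intro z hz hRz
      rw [le_div_iff₀ (by positivity)]
      refine le_trans ?_ (hb z hz)
      gcongr
    have h := Complex.integral_boundary_rect_eq_zero_of_differentiableOn G (-R : ℂ)
      (R + R * Complex.I) (fun z hz => (hG z ?_).differentiableWithinAt)
    · simp only [Complex.neg_re, Complex.ofReal_re, Complex.add_re, Complex.mul_re, Complex.I_re,
        mul_zero, Complex.ofReal_im, Complex.I_im, mul_one, sub_self, add_zero, Complex.neg_im,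
        neg_zero, Complex.ofReal_zero, zero_mul, Complex.add_im, Complex.mul_im, zero_add,
        Complex.ofReal_neg, smul_eq_mul] at h
      have h1 : ‖∫ x in (-R)..R, G (x + R * Complex.I)‖ ≤ C / R ^ 2 * |R - -R| := by
        refine intervalIntegral.norm_integral_le_of_norm_le_const fun x _ => hbd _ (by simp [hR.le]) ?_
        simpa [abs_of_pos hR] using Complex.abs_im_le_norm ((x : ℂ) + R * Complex.I)
      have h2 : ‖∫ y in (0 : ℝ)..R, G (R + y * Complex.I)‖ ≤ C / R ^ 2 * |R - 0| := by
        refine intervalIntegral.norm_integral_le_of_norm_le_const fun y hy => hbd _ ?_ ?_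
        · rw [Set.uIoc_of_le hR.le] at hy
          simpa using hy.1.le
        · simpa [abs_of_pos hR] using Complex.abs_re_le_norm ((R : ℂ) + y * Complex.I)
      have h3 : ‖∫ y in (0 : ℝ)..R, G (-R + y * Complex.I)‖ ≤ C / R ^ 2 * |R - 0| := by
        refine intervalIntegral.norm_integral_le_of_norm_le_const fun y hy => hbd _ ?_ ?_
        · rw [Set.uIoc_of_le hR.le] at hy
          simpa using hy.1.le
        · simpa [abs_of_pos hR] using Complex.abs_re_le_norm (-(R : ℂ) + y * Complex.I)
      have h4 : ∫ x in (-R)..R, G x = (∫ x in (-R)..R, G (x + R * Complex.I))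
          - Complex.I * (∫ y in (0 : ℝ)..R, G (R + y * Complex.I))
          + Complex.I * ∫ y in (0 : ℝ)..R, G (-R + y * Complex.I) := by
        linear_combination h
      rw [h4]
      refine (norm_add_le _ _).trans ((add_le_add (norm_sub_le _ _) le_rfl).trans ?_)
      rw [norm_mul, norm_mul, Complex.norm_I, one_mul, one_mul]
      refine (add_le_add (add_le_add h1 h2) h3).trans (le_of_eq ?_)
      rw [sub_zero, sub_neg_eq_add, abs_of_pos hR, abs_of_pos (by linarith)]
      field_simp
      ring
    · have := hz.2
      simp only [Complex.neg_im, Complex.ofReal_im, neg_zero, Complex.add_im, Complex.mul_im,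
        Complex.ofReal_re, Complex.I_im, mul_one, Complex.I_re, mul_zero, add_zero, zero_add] at this
      rw [Set.uIcc_of_le hR.le] at this
      exact this.1
  have hlim := (intervalIntegral_tendsto_integral hi tendsto_neg_atTop_atBot tendsto_id).norm
  have h0 : Tendsto (fun R : ℝ => 4 * C / R) atTop (nhds 0) := tendsto_id.const_div_atTop _
  refine norm_le_zero_iff.1 (le_of_tendsto_of_tendsto hlim h0 ?_)
  filter_upwards [eventually_gt_atTop 0] with R hR using key R hR

theorem one_add_sq_mul_normSq_le_norm_one_sub_sq {δ : ℝ} (hδ : 0 ≤ δ) {z : ℂ} (hz : 0 ≤ z.im) :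
    1 + δ ^ 2 * ‖z‖ ^ 2 ≤ ‖(1 - Complex.I * δ * z) ^ 2‖ := by
  rw [norm_pow, Complex.sq_norm, Complex.sq_norm, Complex.normSq_apply, Complex.normSq_apply]
  simp
  nlinarith [mul_nonneg hδ hz]

theorem one_sub_I_mul_ne_zero {δ : ℝ} (hδ : 0 ≤ δ) {z : ℂ} (hz : 0 ≤ z.im) :
    1 - Complex.I * δ * z ≠ 0 := by
  intro h
  have := one_add_sq_mul_normSq_le_norm_one_sub_sq hδ hz
  rw [h] at this
  norm_num at this
  nlinarith [mul_nonneg (sq_nonneg δ) (sq_nonneg ‖z‖)]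

section Damped

variable {F : ℂ → ℂ} (hF : ∀ z : ℂ, 0 ≤ z.im → DifferentiableAt ℂ F z)
  (hb : ∀ z : ℂ, 0 ≤ z.im → ‖F z‖ ≤ 1) {δ : ℝ}
include hF

theorem differentiableAt_div_one_sub_sq (hδ : 0 < δ) {z : ℂ} (hz : 0 ≤ z.im) :
    DifferentiableAt ℂ (fun z => F z / (1 - Complex.I * δ * z) ^ 2) z :=
  (hF z hz).div (by fun_prop) (pow_ne_zero _ (one_sub_I_mul_ne_zero hδ.le hz))

theorem continuous_div_one_sub_sq (hδ : 0 < δ) :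
    Continuous (fun x : ℝ => F x / (1 - Complex.I * δ * x) ^ 2) := by
  rw [continuous_iff_continuousAt]
  intro x
  exact ContinuousAt.comp (f := fun x : ℝ => (x : ℂ))
    (differentiableAt_div_one_sub_sq hF hδ (z := x) (by simp)).continuousAt
    Complex.continuous_ofReal.continuousAt

omit hF in
include hb in
theorem norm_div_one_sub_sq_le (hδ : 0 < δ) {z : ℂ} (hz : 0 ≤ z.im) :
    ‖F z / (1 - Complex.I * δ * z) ^ 2‖ ≤ (1 + δ ^ 2 * ‖z‖ ^ 2)⁻¹ := by
  rw [norm_div, div_eq_mul_inv]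
  have := one_add_sq_mul_normSq_le_norm_one_sub_sq hδ.le hz
  have h2 : (‖(1 - Complex.I * δ * z) ^ 2‖)⁻¹ ≤ (1 + δ ^ 2 * ‖z‖ ^ 2)⁻¹ := by
    gcongr
  calc _ ≤ 1 * (‖(1 - Complex.I * δ * z) ^ 2‖)⁻¹ := by gcongr; exact hb z hz
    _ ≤ _ := by rwa [one_mul]

include hb in
theorem integrable_div_one_sub_sq (hδ : 0 < δ) :
    Integrable (fun x : ℝ => F x / (1 - Complex.I * δ * x) ^ 2) := by
  have h : Integrable (fun x : ℝ => (1 + (δ * x) ^ 2)⁻¹) :=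
    integrable_inv_one_add_sq.comp_mul_left' hδ.ne'
  refine h.mono' (continuous_div_one_sub_sq hF hδ).aestronglyMeasurable (ae_of_all _ fun x => ?_)
  refine (norm_div_one_sub_sq_le hb hδ (z := x) (by simp)).trans (le_of_eq ?_)
  simp [mul_pow]

include hb in
theorem fourier_div_one_sub_sq_eq_zero (hδ : 0 < δ) {s : ℝ} (hs : s ≤ 0) :
    𝓕 ((fun x : ℝ => F x / (1 - Complex.I * δ * x) ^ 2) : ℝ → ℂ) s = 0 := by
  rw [Real.fourier_real_eq_integral_exp_smul]
  have key := integral_eq_zero_of_differentiableAt_upperHalfPlane (C := (δ ^ 2)⁻¹)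
    (G := fun z => Complex.exp (-2 * Real.pi * z * s * Complex.I) •
      (F z / (1 - Complex.I * δ * z) ^ 2)) ?_ ?_ ?_
  · simpa using key
  · intro z hz
    have he : DifferentiableAt ℂ (fun z => Complex.exp (-2 * Real.pi * z * s * Complex.I)) z := by
      fun_prop
    exact he.fun_smul (differentiableAt_div_one_sub_sq hF hδ hz)
  · intro z hz
    have he : ‖Complex.exp (-2 * Real.pi * z * s * Complex.I)‖ ≤ 1 := by
      rw [Complex.norm_exp, Real.exp_le_one_iff]
      simp
      have := mul_nonneg (mul_nonneg Real.pi_pos.le hz) (neg_nonneg.2 hs)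
      nlinarith
    rw [norm_smul]
    calc _ ≤ 1 * (1 + δ ^ 2 * ‖z‖ ^ 2)⁻¹ * ‖z‖ ^ 2 := by
          gcongr
          exact norm_div_one_sub_sq_le hb hδ hz
      _ ≤ _ := by
          rw [one_mul, inv_mul_le_iff₀ (by positivity)]
          field_simp
          linarith
  · refine (integrable_div_one_sub_sq hF hb hδ).mono (Continuous.aestronglyMeasurable ?_)
      (ae_of_all _ fun x => ?_)
    · have he : Continuous fun x : ℝ => Complex.exp (-2 * Real.pi * x * s * Complex.I) := by
        fun_prop
      exact he.smul (continuous_div_one_sub_sq hF hδ)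
    · rw [norm_smul]
      have : ‖Complex.exp (-2 * Real.pi * x * s * Complex.I)‖ = 1 := by
        rw [Complex.norm_exp]
        simp
      rw [this, one_mul]

end Damped

/-- If all translates of a set are null for some nonzero finite measure on `ℝ`, then the set is
Lebesgue null. -/
theorem volume_eq_zero_of_forall_translate_null (σ : Measure ℝ) [IsFiniteMeasure σ] (hσ : σ ≠ 0)
    {D : Set ℝ} (hD : MeasurableSet D) (h : ∀ t : ℝ, σ ((· + t) '' D) = 0) : volume D = 0 := by
  have hm : MeasurableSet {p : ℝ × ℝ | p.2 - p.1 ∈ D} :=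
    (measurable_snd.sub measurable_fst) hD
  have h1 : (volume.prod σ) {p : ℝ × ℝ | p.2 - p.1 ∈ D} = 0 := by
    rw [Measure.measure_prod_null hm]
    refine ae_of_all _ fun t => ?_
    have := h t
    rw [Set.image_add_right] at this
    simpa [Set.preimage, sub_eq_add_neg] using this
  rw [Measure.prod_apply_symm hm] at h1
  have h2 : ∀ x : ℝ, volume ((fun t => (t, x)) ⁻¹' {p : ℝ × ℝ | p.2 - p.1 ∈ D}) = volume D := by
    intro x
    exact (Measure.measurePreserving_sub_left volume x).measure_preimage hD.nullMeasurableSet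
  simp only [h2, lintegral_const, mul_eq_zero, Measure.measure_univ_eq_zero] at h1
  exact h1.resolve_right hσ

theorem norm_le_norm_add_mul_I (c δ : ℝ) (hδ : 0 < δ) {z : ℂ} (hz : 0 ≤ z.im) :
    δ ≤ ‖z - c + δ * Complex.I‖ := by
  have := Complex.abs_im_le_norm (z - c + δ * Complex.I)
  have h : (z - c + δ * Complex.I).im = z.im + δ := by simp
  rw [h, abs_of_nonneg (by linarith)] at this
  linarith

/-- The Cauchy transform of a set, shifted into the upper half-plane by `δ`. -/
noncomputable def shiftedCauchyTransform (U : Set ℝ) (δ : ℝ) (z : ℂ) : ℂ :=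
  ∫ c in U, Complex.I / (z - c + δ * Complex.I)

section Cauchy

variable {U : Set ℝ} {δ : ℝ}

theorem norm_I_div_le (hδ : 0 < δ) (c : ℝ) {z : ℂ} (hz : 0 ≤ z.im) :
    ‖Complex.I / (z - c + δ * Complex.I)‖ ≤ δ⁻¹ := by
  rw [norm_div, Complex.norm_I, one_div]
  gcongr
  exact norm_le_norm_add_mul_I c δ hδ hz

theorem integrableOn_I_div (hU : volume U ≠ ⊤) (hδ : 0 < δ) {z : ℂ} (hz : 0 ≤ z.im) :
    IntegrableOn (fun c : ℝ => Complex.I / (z - c + δ * Complex.I)) U := by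
  refine Measure.integrableOn_of_bounded (M := δ⁻¹) hU ?_ (ae_of_all _ fun c => norm_I_div_le hδ c hz)
  exact Measurable.aestronglyMeasurable (by fun_prop)

theorem differentiableAt_shiftedCauchyTransform (hU : volume U ≠ ⊤) (hδ : 0 < δ) {z : ℂ}
    (hz : 0 ≤ z.im) : DifferentiableAt ℂ (shiftedCauchyTransform U δ) z := by
  have hlow : ∀ w ∈ Metric.ball z (δ / 2), ∀ c : ℝ, δ / 2 ≤ ‖w - c + δ * Complex.I‖ := by
    intro w hw c
    have h1 := norm_le_norm_add_mul_I c δ hδ hz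
    rw [mem_ball_iff_norm'] at hw
    have h2 := norm_add_le (z - w) (w - c + δ * Complex.I)
    rw [show z - w + (w - c + δ * Complex.I) = z - c + δ * Complex.I by ring] at h2
    linarith
  have : IsFiniteMeasure (volume.restrict U) := ⟨by simpa using hU.lt_top⟩
  refine (hasDerivAt_integral_of_dominated_loc_of_deriv_le (μ := volume.restrict U)
    (F := fun z c => Complex.I / (z - (c : ℝ) + δ * Complex.I))
    (F' := fun z c => -Complex.I / (z - (c : ℝ) + δ * Complex.I) ^ 2)
    (bound := fun _ => ((δ / 2) ^ 2)⁻¹) (Metric.ball_mem_nhds z (half_pos hδ)) ?_ ?_ ?_ ?_ ?_ ?_).2.differentiableAt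
  · exact Eventually.of_forall fun w => Measurable.aestronglyMeasurable (by fun_prop)
  · exact integrableOn_I_div hU hδ hz
  · exact Measurable.aestronglyMeasurable (by fun_prop)
  · refine ae_of_all _ fun c w hw => ?_
    rw [norm_div, norm_neg, Complex.norm_I, one_div, norm_pow]
    gcongr
    exact hlow w hw c
  · exact integrable_const _
  · refine ae_of_all _ fun c w hw => ?_
    have hne : w - c + δ * Complex.I ≠ 0 := by
      rw [← norm_pos_iff]
      linarith [hlow w hw c]
    have hd : HasDerivAt (fun w : ℂ => w - c + δ * Complex.I) 1 w :=
      ((hasDerivAt_id w).sub_const _).add_const _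
    have h := (hasDerivAt_const w Complex.I).fun_div hd hne
    rwa [zero_mul, mul_one, zero_sub] at h

theorem re_I_div (w : ℂ) : (Complex.I / w).re = w.im / Complex.normSq w := by
  simp [Complex.div_re]

theorem re_shiftedCauchyTransform (hU : volume U ≠ ⊤) (hδ : 0 < δ) {z : ℂ} (hz : 0 ≤ z.im) :
    (shiftedCauchyTransform U δ z).re =
      ∫ c in U, (Complex.I / (z - (c : ℝ) + δ * Complex.I)).re :=
  (integral_re (integrableOn_I_div hU hδ hz)).symm

theorem re_I_div_nonneg (hδ : 0 < δ) (c : ℝ) {z : ℂ} (hz : 0 ≤ z.im) :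
    0 ≤ (Complex.I / (z - c + δ * Complex.I)).re := by
  rw [re_I_div]
  refine div_nonneg ?_ (Complex.normSq_nonneg _)
  simp
  linarith

theorem re_shiftedCauchyTransform_nonneg (hU : volume U ≠ ⊤) (hδ : 0 < δ) {z : ℂ}
    (hz : 0 ≤ z.im) : 0 ≤ (shiftedCauchyTransform U δ z).re := by
  rw [re_shiftedCauchyTransform hU hδ hz]
  exact integral_nonneg fun c => re_I_div_nonneg hδ c hz

theorem one_le_re_shiftedCauchyTransform (hU : volume U ≠ ⊤) (hδ : 0 < δ) {x : ℝ}
    (hx : Metric.ball x δ ⊆ U) : 1 ≤ (shiftedCauchyTransform U δ x).re := by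
  have hz : 0 ≤ (x : ℂ).im := by simp
  rw [re_shiftedCauchyTransform hU hδ hz]
  have hi : IntegrableOn (fun c : ℝ => (Complex.I / ((x : ℂ) - c + δ * Complex.I)).re) U :=
    (integrableOn_I_div hU hδ hz).re
  refine le_trans ?_ (setIntegral_mono_set hi (ae_of_all _ fun c => re_I_div_nonneg hδ c hz)
    hx.eventuallyLE)
  have h := setIntegral_ge_of_const_le (c := (2 * δ)⁻¹) (μ := volume) (s := Metric.ball x δ)
    measurableSet_ball measure_ball_lt_top.ne (fun c hc => ?_) (hi.mono_set hx)
  · refine le_trans (le_of_eq ?_) h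
    rw [measureReal_def, Real.volume_ball, ENNReal.toReal_ofReal (by positivity), smul_eq_mul]
    field_simp
  · rw [re_I_div, Complex.normSq_apply]
    rw [Metric.mem_ball, Real.dist_eq] at hc
    have h1 : (x - c) ^ 2 ≤ δ ^ 2 := sq_le_sq' (by linarith [le_abs_self (c - x)])
      (by linarith [neg_abs_le (c - x)])
    simp only [Complex.add_im, Complex.sub_im, Complex.ofReal_im, Complex.mul_im, Complex.ofReal_re,
      Complex.I_im, Complex.I_re, Complex.add_re, Complex.sub_re, Complex.mul_re, mul_one, mul_zero,
      sub_self, zero_add, add_zero]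
    rw [inv_eq_one_div, div_le_div_iff₀ (by positivity) (by nlinarith [mul_self_nonneg (x - c), mul_pos hδ hδ])]
    nlinarith

theorem norm_shiftedCauchyTransform_le (hU : volume U ≠ ⊤) {x r : ℝ} (hr : 0 < r)
    (hx : ∀ c ∈ U, r ≤ |x - c|) : ‖shiftedCauchyTransform U δ x‖ ≤ r⁻¹ * volume.real U := by
  refine norm_setIntegral_le_of_norm_le_const hU.lt_top fun c hc => ?_
  rw [norm_div, Complex.norm_I, one_div]
  gcongr
  refine (hx c hc).trans ?_
  simpa using Complex.abs_re_le_norm ((x : ℂ) - c + δ * Complex.I)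

end Cauchy

/-- A compact Lebesgue null set carries an approximate peak function that is holomorphic on the closed
upper half-plane and bounded by `1` there. -/
theorem exists_bounded_analytic_peak {K : Set ℝ} (hK : IsCompact K)
    (hK0 : volume K = 0) {ε : ℝ} (hε : 0 < ε) :
    ∃ F : ℂ → ℂ, (∀ z : ℂ, 0 ≤ z.im → DifferentiableAt ℂ F z) ∧ (∀ z : ℂ, 0 ≤ z.im → ‖F z‖ ≤ 1) ∧
      (∀ x ∈ K, ‖F (x : ℝ) - 1‖ ≤ ε) ∧ ∀ x : ℝ, ε ≤ Metric.infDist x K → ‖F x‖ ≤ ε := by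
  have hfin : ∀ δ : ℝ, volume (Metric.thickening δ K) ≠ ⊤ := fun δ =>
    hK.isBounded.thickening.measure_lt_top.ne
  have hlim := tendsto_measure_thickening_of_isClosed (μ := volume) (s := K) ⟨1, one_pos, hfin 1⟩
    hK.isClosed
  rw [hK0] at hlim
  have hpos : (0 : ENNReal) < ENNReal.ofReal (ε ^ 3 / 2) := ENNReal.ofReal_pos.2 (by positivity)
  obtain ⟨δ, hδV, hδ, hδε⟩ := ((hlim.eventually (gt_mem_nhds hpos)).and
    (Ioo_mem_nhdsGT (half_pos hε))).exists
  have hV : volume.real (Metric.thickening δ K) ≤ ε ^ 3 / 2 :=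
    ENNReal.toReal_le_of_le_ofReal (by positivity) hδV.le
  set U := Metric.thickening δ K with hU
  set q : ℂ → ℂ := fun z => (ε⁻¹ : ℝ) * shiftedCauchyTransform U δ z with hq
  have hqre : ∀ z, (q z).re = ε⁻¹ * (shiftedCauchyTransform U δ z).re := fun z =>
    Complex.re_ofReal_mul _ _
  have hq0 : ∀ z : ℂ, 0 ≤ z.im → 0 ≤ (q z).re := fun z hz => by
    rw [hqre]
    exact mul_nonneg (by positivity) (re_shiftedCauchyTransform_nonneg (hfin δ) hδ hz)
  have hre : ∀ z : ℂ, (1 + q z).re ≤ ‖1 + q z‖ := fun z => Complex.re_le_norm _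
  have hone : ∀ z : ℂ, 0 ≤ z.im → 1 ≤ ‖1 + q z‖ := fun z hz => by
    have := hre z
    rw [Complex.add_re, Complex.one_re] at this
    linarith [hq0 z hz]
  have hne : ∀ z : ℂ, 0 ≤ z.im → 1 + q z ≠ 0 := fun z hz => by
    rw [← norm_pos_iff]
    linarith [hone z hz]
  have hqd : ∀ z : ℂ, 0 ≤ z.im → DifferentiableAt ℂ q z := fun z hz =>
    (differentiableAt_shiftedCauchyTransform (hfin δ) hδ hz).const_mul _
  refine ⟨fun z => q z / (1 + q z), fun z hz => ?_, fun z hz => ?_, fun x hx => ?_, fun x hx => ?_⟩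
  · exact (hqd z hz).div ((hqd z hz).const_add _) (hne z hz)
  · rw [norm_div, div_le_one (by linarith [hone z hz])]
    refine le_of_sq_le_sq ?_ (norm_nonneg _)
    rw [Complex.sq_norm, Complex.sq_norm, Complex.normSq_apply, Complex.normSq_apply]
    simp
    nlinarith [hq0 z hz]
  · have hz : 0 ≤ (x : ℂ).im := by simp
    have hn := hne x hz
    rw [show q x / (1 + q x) - 1 = -(1 / (1 + q x)) by field_simp; ring, norm_neg, norm_div, norm_one,
      div_le_iff₀ (by linarith [hone x hz])]
    have h1 : 1 ≤ (shiftedCauchyTransform U δ x).re :=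
      one_le_re_shiftedCauchyTransform (hfin δ) hδ (Metric.ball_subset_thickening hx δ)
    have h2 := hre x
    rw [Complex.add_re, Complex.one_re, hqre] at h2
    have h3 : ε⁻¹ * 1 ≤ ε⁻¹ * (shiftedCauchyTransform U δ x).re := by gcongr
    calc (1 : ℝ) = ε * ε⁻¹ := (mul_inv_cancel₀ hε.ne').symm
      _ ≤ ε * ‖1 + q x‖ := by gcongr; linarith
  · have hz : 0 ≤ (x : ℂ).im := by simp
    have h1 : ‖shiftedCauchyTransform U δ x‖ ≤ (ε / 2)⁻¹ * volume.real U := by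
      refine norm_shiftedCauchyTransform_le (hfin δ) (half_pos hε) fun c hc => ?_
      obtain ⟨k, hk, hck⟩ := Metric.mem_thickening_iff.1 hc
      have h2 := Metric.infDist_le_dist_of_mem (x := x) hk
      have h3 := dist_triangle x c k
      rw [Real.dist_eq x c] at h3
      linarith
    rw [norm_div]
    calc ‖q x‖ / ‖1 + q x‖ ≤ ‖q x‖ := div_le_self (norm_nonneg _) (hone x hz)
      _ = ε⁻¹ * ‖shiftedCauchyTransform U δ x‖ := by
          rw [hq, norm_mul, Complex.norm_real, Real.norm_of_nonneg (by positivity)]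
      _ ≤ ε⁻¹ * ((ε / 2)⁻¹ * (ε ^ 3 / 2)) := by gcongr; exact h1.trans (by gcongr)
      _ = ε := by field_simp

section Annihilation

variable {ρ : Measure ℝ} [IsFiniteMeasure ρ] {f : ℝ → ℂ}

theorem integral_intervalIntegral_mul_eq_zero (hf : Integrable f ρ) {g : ℝ → ℂ}
    (hgi : Integrable g) {η : ℝ} (hη : 0 ≤ η)
    (h : ∫ t : ℝ, g t * (∫ x in (· + t) '' Set.Ico 0 η, f x ∂ρ) = 0) :
    ∫ x, (∫ t in (x - η)..x, g t) * f x ∂ρ = 0 := by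
  set S : Set (ℝ × ℝ) := {p | p.2 - p.1 ∈ Set.Ico 0 η} with hS
  have hSm : MeasurableSet S := (measurable_snd.sub measurable_fst) measurableSet_Ico
  have hint : Integrable (Function.uncurry fun t x => S.indicator (fun p => g p.1 * f p.2) (t, x))
      (volume.prod ρ) := (hgi.mul_prod hf).indicator hSm
  rw [← h]
  have h1 : ∀ t : ℝ, g t * (∫ x in (· + t) '' Set.Ico 0 η, f x ∂ρ) =
      ∫ x, S.indicator (fun p => g p.1 * f p.2) (t, x) ∂ρ := fun t => by
    have hm : MeasurableSet ((· + t) '' Set.Ico 0 η) := by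
      rw [Set.image_add_right]
      exact (measurable_add_const _) measurableSet_Ico
    rw [← integral_const_mul, ← integral_indicator hm]
    congr 1 with x
    have : x ∈ (· + t) '' Set.Ico 0 η ↔ (t, x) ∈ S := by
      rw [Set.image_add_right]
      simp [hS, sub_eq_add_neg]
    by_cases hx : (t, x) ∈ S
    · rw [Set.indicator_of_mem hx, Set.indicator_of_mem (this.2 hx)]
    · rw [Set.indicator_of_notMem hx, Set.indicator_of_notMem (mt this.1 hx)]
  simp_rw [h1]
  rw [integral_integral_swap hint]
  congr 1 with x
  rw [intervalIntegral.integral_of_le (by linarith), ← integral_mul_const,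
    ← integral_indicator measurableSet_Ioc]
  congr 1 with t
  have : t ∈ Set.Ioc (x - η) x ↔ (t, x) ∈ S := by
    simp only [hS, Set.mem_ofPred_eq, Set.mem_Ioc, Set.mem_Ico]
    constructor <;> rintro ⟨h1, h2⟩ <;> constructor <;> linarith
  by_cases hx : (t, x) ∈ S
  · rw [Set.indicator_of_mem hx, Set.indicator_of_mem (this.2 hx)]
  · rw [Set.indicator_of_notMem hx, Set.indicator_of_notMem (mt this.1 hx)]

theorem integral_mul_eq_zero_of_forall_translate (hf : Integrable f ρ) {g : ℝ → ℂ}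
    (hgi : Integrable g) (hgc : Continuous g) {C : ℝ} (hgb : ∀ x, ‖g x‖ ≤ C)
    (h : ∀ A : Set ℝ, MeasurableSet A → ∫ t : ℝ, g t * (∫ x in (· + t) '' A, f x ∂ρ) = 0) :
    ∫ x, g x * f x ∂ρ = 0 := by
  have hlim : Tendsto (fun η : ℝ => ∫ x, (η⁻¹ • ∫ t in (x - η)..x, g t) * f x ∂ρ)
      (nhdsWithin 0 (Set.Ioi 0)) (nhds (∫ x, g x * f x ∂ρ)) := by
    refine tendsto_integral_filter_of_dominated_convergence (fun x => C * ‖f x‖) ?_ ?_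
      (hf.norm.const_mul C) (ae_of_all _ fun x => ?_)
    · refine Eventually.of_forall fun η => AEStronglyMeasurable.mul ?_ hf.1
      have hp : Continuous fun x : ℝ => ∫ t in (0 : ℝ)..x, g t :=
        intervalIntegral.continuous_primitive (fun a b => hgi.intervalIntegrable) 0
      have he : (fun x : ℝ => η⁻¹ • ∫ t in (x - η)..x, g t) =
          fun x => η⁻¹ • ((∫ t in (0 : ℝ)..x, g t) - ∫ t in (0 : ℝ)..(x - η), g t) := by
        ext x
        rw [intervalIntegral.integral_interval_sub_left] <;> exact hgi.intervalIntegrable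
      rw [he]
      have hp' : Continuous fun x : ℝ => ∫ t in (0 : ℝ)..(x - η), g t :=
        hp.comp (continuous_sub_right η)
      exact ((hp.fun_sub hp').fun_const_smul _).aestronglyMeasurable
    · filter_upwards [self_mem_nhdsWithin] with η (hη : 0 < η)
      refine ae_of_all _ fun x => ?_
      rw [norm_mul, norm_smul]
      gcongr
      have := intervalIntegral.norm_integral_le_of_norm_le_const (a := x - η) (b := x)
        (fun t _ => hgb t)
      rw [sub_sub_cancel, abs_of_pos hη] at this
      rw [norm_inv, Real.norm_of_nonneg hη.le, inv_mul_le_iff₀ hη]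
      linarith
    · refine Tendsto.mul_const _ ?_
      have hd : HasDerivAt (fun u => ∫ t in u..x, g t) (-g x) x :=
        intervalIntegral.integral_hasDerivAt_left hgi.intervalIntegrable
          (hgc.stronglyMeasurableAtFilter _ _) hgc.continuousAt
      have hd2 : HasDerivAt (fun η => ∫ t in (x - η)..x, g t) (g x) 0 := by
        have hd' : HasDerivAt (fun u => ∫ t in u..x, g t) (-g x) (x - 0) := by rwa [sub_zero]
        have := hd'.scomp (0 : ℝ) ((hasDerivAt_id (0 : ℝ)).const_sub x)
        simpa [Function.comp_def] using this
      have := hd2.tendsto_slope_zero_right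
      simpa using this
  refine tendsto_nhds_unique hlim (Tendsto.congr' ?_ tendsto_const_nhds)
  filter_upwards [self_mem_nhdsWithin] with η (hη : 0 < η)
  have := integral_intervalIntegral_mul_eq_zero hf hgi hη.le (h _ measurableSet_Ico)
  simp_rw [smul_mul_assoc]
  rw [integral_smul, this, smul_zero]

variable (hf : Integrable f ρ)
  (hanal : ∀ A : Set ℝ, MeasurableSet A →
    ∀ g : ℝ → ℂ, Integrable g → (∀ s : ℝ, s ≤ 0 → 𝓕 g s = 0) →
      ∫ t : ℝ, g t * (∫ x in (· + t) '' A, f x ∂ρ) = 0)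
include hf hanal

theorem integral_analytic_mul_eq_zero {F : ℂ → ℂ}
    (hF : ∀ z : ℂ, 0 ≤ z.im → DifferentiableAt ℂ F z)
    (hb : ∀ z : ℂ, 0 ≤ z.im → ‖F z‖ ≤ 1) : ∫ x : ℝ, F x * f x ∂ρ = 0 := by
  have hbd : ∀ δ : ℝ, 0 < δ → ∀ x : ℝ, ‖F x / (1 - Complex.I * δ * x) ^ 2‖ ≤ 1 := fun δ hδ x =>
    (norm_div_one_sub_sq_le hb hδ (z := x) (by simp)).trans
      (inv_le_one_of_one_le₀ (by nlinarith [mul_nonneg (sq_nonneg δ) (sq_nonneg ‖(x : ℂ)‖)]))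
  have hlim : Tendsto (fun δ : ℝ => ∫ x : ℝ, F x / (1 - Complex.I * δ * x) ^ 2 * f x ∂ρ)
      (nhdsWithin 0 (Set.Ioi 0)) (nhds (∫ x : ℝ, F x * f x ∂ρ)) := by
    refine tendsto_integral_filter_of_dominated_convergence (fun x => ‖f x‖) ?_ ?_ hf.norm
      (ae_of_all _ fun x => ?_)
    · filter_upwards [self_mem_nhdsWithin] with δ (hδ : 0 < δ)
      exact (continuous_div_one_sub_sq hF hδ).aestronglyMeasurable.mul hf.1
    · filter_upwards [self_mem_nhdsWithin] with δ (hδ : 0 < δ)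
      refine ae_of_all _ fun x => ?_
      rw [norm_mul]
      exact mul_le_of_le_one_left (norm_nonneg _) (hbd δ hδ x)
    · refine Tendsto.mul_const _ (tendsto_nhdsWithin_of_tendsto_nhds ?_)
      have : ContinuousAt (fun δ : ℝ => F x / (1 - Complex.I * δ * x) ^ 2) 0 :=
        ContinuousAt.div (by fun_prop) (by fun_prop) (by simp)
      simpa [ContinuousAt] using this
  refine tendsto_nhds_unique hlim (Tendsto.congr' ?_ tendsto_const_nhds)
  filter_upwards [self_mem_nhdsWithin] with δ (hδ : 0 < δ)
  exact (integral_mul_eq_zero_of_forall_translate hf (integrable_div_one_sub_sq hF hb hδ)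
    (continuous_div_one_sub_sq hF hδ) (hbd δ hδ) fun A hA => hanal A hA _
    (integrable_div_one_sub_sq hF hb hδ) fun s hs => fourier_div_one_sub_sq_eq_zero hF hb hδ hs).symm

theorem setIntegral_eq_zero_of_isCompact {K : Set ℝ} (hK : IsCompact K) (hK0 : volume K = 0) :
    ∫ x in K, f x ∂ρ = 0 := by
  rcases K.eq_empty_or_nonempty with rfl | hne
  · simp
  choose F hF hb hF1 hF0 using fun n : ℕ =>
    exists_bounded_analytic_peak hK hK0 (ε := 1 / ((n : ℝ) + 1)) (by positivity)
  have hε := tendsto_one_div_add_atTop_nhds_zero_nat (𝕜 := ℝ)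
  have hlim : Tendsto (fun n => ∫ x : ℝ, F n x * f x ∂ρ) atTop
      (nhds (∫ x, K.indicator f x ∂ρ)) := by
    refine tendsto_integral_of_dominated_convergence (fun x => ‖f x‖) (fun n => ?_) hf.norm
      (fun n => ae_of_all _ fun x => ?_) (ae_of_all _ fun x => ?_)
    · refine AEStronglyMeasurable.mul (Continuous.aestronglyMeasurable ?_) hf.1
      refine continuous_iff_continuousAt.2 fun x => ?_
      exact ContinuousAt.comp (f := fun x : ℝ => (x : ℂ)) (hF n x (by simp)).continuousAt
        Complex.continuous_ofReal.continuousAt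
    · rw [norm_mul]
      exact mul_le_of_le_one_left (norm_nonneg _) (hb n x (by simp))
    · by_cases hx : x ∈ K
      · rw [Set.indicator_of_mem hx]
        have : Tendsto (fun n => F n x) atTop (nhds 1) :=
          tendsto_iff_norm_sub_tendsto_zero.2
            (squeeze_zero (fun _ => norm_nonneg _) (fun n => hF1 n x hx) hε)
        simpa using this.mul_const (f x)
      · rw [Set.indicator_of_notMem hx]
        have hpos := (hK.isClosed.notMem_iff_infDist_pos hne).1 hx
        have : Tendsto (fun n => F n x) atTop (nhds 0) := by
          refine squeeze_zero_norm' ?_ hε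
          filter_upwards [hε.eventually (gt_mem_nhds hpos)] with n hn using hF0 n x hn.le
        simpa using this.mul_const (f x)
  rw [integral_indicator hK.measurableSet] at hlim
  refine tendsto_nhds_unique hlim (tendsto_const_nhds.congr fun n => ?_)
  exact (integral_analytic_mul_eq_zero hf hanal (hF n) (hb n)).symm

/-- **F. and M. Riesz theorem** on the real line: a weakly analytic measure is absolutely
continuous with respect to Lebesgue measure. -/
theorem setIntegral_eq_zero_of_volume_eq_zero {B : Set ℝ} (hB : MeasurableSet B)
    (hB0 : volume B = 0) : ∫ x in B, f x ∂ρ = 0 := by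
  have : IsFiniteMeasure (ρ.withDensity fun x => ‖f x‖ₑ) := isFiniteMeasure_withDensity hf.2.ne
  rw [← enorm_eq_zero]
  refine nonpos_iff_eq_zero.1 (le_of_forall_pos_le_add fun ε hε => ?_)
  rw [zero_add]
  obtain ⟨K, hKB, hK, hKε⟩ := hB.exists_isCompact_sdiff_lt
    (measure_ne_top (ρ.withDensity fun x => ‖f x‖ₑ) B) hε.ne'
  have hK0 := setIntegral_eq_zero_of_isCompact hf hanal hK (measure_mono_null hKB hB0)
  have hdiff : MeasurableSet (B \ K) := hB.diff hK.measurableSet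
  have h := setIntegral_union (Set.disjoint_sdiff_right (s := K) (t := B)) hdiff
    hf.integrableOn hf.integrableOn
  rw [Set.union_sdiff_cancel hKB, hK0, zero_add] at h
  rw [h]
  refine (enorm_integral_le_lintegral_enorm _).trans ?_
  rw [← withDensity_apply _ hdiff]
  exact hKε.le

end Annihilation

theorem stmt11
    -- the quasi-invariant finite positive Borel measure σ
    (σ : Measure ℝ) [IsFiniteMeasure σ]
    (hqi : ∀ t : ℝ, ∀ A : Set ℝ, MeasurableSet A →
      (σ A = 0 ↔ σ ((· + t) '' A) = 0))
    -- the complex measure μ, represented by the pair (ρ, f)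
    (ρ : Measure ℝ) [IsFiniteMeasure ρ] (f : ℝ → ℂ) (hf : Integrable f ρ)
    -- μ is weakly measurable and weakly analytic for the translation action
    (hmeas : ∀ A : Set ℝ, MeasurableSet A →
      Measurable (fun t : ℝ => ∫ x in (· + t) '' A, f x ∂ρ))
    (hanal : ∀ A : Set ℝ, MeasurableSet A →
      ∀ g : ℝ → ℂ, Integrable g → (∀ s : ℝ, s ≤ 0 → 𝓕 g s = 0) →
        ∫ t : ℝ, g t * (∫ x in (· + t) '' A, f x ∂ρ) = 0)
    -- the complex measures μ₁ and μ₂, represented by (ρ₁, f₁) and (ρ₂, f₂)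
    (ρ₁ : Measure ℝ) [IsFiniteMeasure ρ₁] (f₁ : ℝ → ℂ) (hf₁ : Integrable f₁ ρ₁)
    (ρ₂ : Measure ℝ) [IsFiniteMeasure ρ₂] (f₂ : ℝ → ℂ) (hf₂ : Integrable f₂ ρ₂)
    -- μ = μ₁ + μ₂
    (hsum : ∀ A : Set ℝ, MeasurableSet A →
      ∫ x in A, f x ∂ρ = (∫ x in A, f₁ x ∂ρ₁) + ∫ x in A, f₂ x ∂ρ₂)
    -- μ₁ is absolutely continuous with respect to σ
    (hac : ∀ B : Set ℝ, MeasurableSet B → σ B = 0 → ∫ x in B, f₁ x ∂ρ₁ = 0)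
    -- μ₂ is singular with respect to σ
    (hsing : ∃ D : Set ℝ, MeasurableSet D ∧ σ D = 0 ∧
      ∀ B : Set ℝ, MeasurableSet B → B ⊆ Dᶜ → ∫ x in B, f₂ x ∂ρ₂ = 0) :
    (∀ A : Set ℝ, MeasurableSet A →
      Measurable (fun t : ℝ => ∫ x in (· + t) '' A, f₁ x ∂ρ₁) ∧
      ∀ g : ℝ → ℂ, Integrable g → (∀ s : ℝ, s ≤ 0 → 𝓕 g s = 0) →
        ∫ t : ℝ, g t * (∫ x in (· + t) '' A, f₁ x ∂ρ₁) = 0)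
    ∧ (∀ A : Set ℝ, MeasurableSet A →
      Measurable (fun t : ℝ => ∫ x in (· + t) '' A, f₂ x ∂ρ₂) ∧
      ∀ g : ℝ → ℂ, Integrable g → (∀ s : ℝ, s ≤ 0 → 𝓕 g s = 0) →
        ∫ t : ℝ, g t * (∫ x in (· + t) '' A, f₂ x ∂ρ₂) = 0) := by
  have himage : ∀ (A : Set ℝ), MeasurableSet A → ∀ t : ℝ, MeasurableSet ((· + t) '' A) := by
    intro A hA t
    rw [Set.image_add_right]
    exact measurable_add_const _ hA
  by_cases hσ : σ = 0
  · have h1 : ∀ B, MeasurableSet B → ∫ x in B, f₁ x ∂ρ₁ = 0 := fun B hB => hac B hB (by simp [hσ])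
    have h2 : ∀ B, MeasurableSet B → ∫ x in B, f₂ x ∂ρ₂ = ∫ x in B, f x ∂ρ := fun B hB => by
      rw [hsum B hB, h1 B hB, zero_add]
    refine ⟨fun A hA => ?_, fun A hA => ?_⟩
    · simp only [h1 _ (himage A hA _)]
      simp
    · simp only [h2 _ (himage A hA _)]
      exact ⟨hmeas A hA, hanal A hA⟩
  · obtain ⟨D, hD, hσD, hDc⟩ := hsing
    have hvol : volume D = 0 := volume_eq_zero_of_forall_translate_null σ hσ hD fun t =>
      (hqi t D hD).1 hσD
    have h2 : ∀ B, MeasurableSet B → ∫ x in B, f₂ x ∂ρ₂ = 0 := fun B hB => by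
      have hBD := hB.inter hD
      have h := hsum (B ∩ D) hBD
      rw [setIntegral_eq_zero_of_volume_eq_zero hf hanal hBD
        (measure_mono_null Set.inter_subset_right hvol),
        hac _ hBD (measure_mono_null Set.inter_subset_right hσD), zero_add] at h
      rw [← integral_inter_add_sdiff hD hf₂.integrableOn, ← h, zero_add]
      exact hDc _ (hB.diff hD) fun x hx => hx.2
    have h1 : ∀ B, MeasurableSet B → ∫ x in B, f₁ x ∂ρ₁ = ∫ x in B, f x ∂ρ := fun B hB => by
      rw [hsum B hB, h2 B hB, add_zero]
    refine ⟨fun A hA => ?_, fun A hA => ?_⟩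
    · simp only [h1 _ (himage A hA _)]
      exact ⟨hmeas A hA, hanal A hA⟩
    · simp only [h2 _ (himage A hA _)]
      simp
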